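/- Let m ≥ 1 and consider the grid graph on ℤ^m (vertices ℤ^m, edges between points differing by ±1 in exactly one coordinate), which is 2m-regular. Then the set S = { x ∈ ℤ^m : Σᵢ i·xᵢ ≡ 0 (mod 2m+1) } is an independent exact 1-cover: S is independent, and every vertex not in S has exactly one neighbour in S. -/

import Mathlib

open SimpleGraph

/-- `S` is an independent exact `r`-cover of `G`: `S` is independent and every vertex
outside `S` has exactly `r` neighbours in `S`. -/
def IsIndepExactCover {V : Type*} (G : SimpleGraph V) (r : ℕ) (S : Set V) : Prop :=
  (∀ x ∈ S, ∀ y ∈ S, ¬ G.Adj x y) ∧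
  ∀ v ∉ S, (S ∩ G.neighborSet v).ncard = r

/-- Moving along an edge changes coordinate `i` by `e = ±1`, and the weighted sum by `(i+1)e`. -/
theorem aux_sum (m : ℕ) (x y : Fin m → ℤ) (i : Fin m) (h : ∀ j : Fin m, j ≠ i → x j = y j) :
    ∑ k : Fin m, ((k : ℕ) + 1 : ℤ) * y k
      = ∑ k : Fin m, ((k : ℕ) + 1 : ℤ) * x k + ((i : ℕ) + 1 : ℤ) * (y i - x i) := by
  have : ∑ k : Fin m, (((k : ℕ) + 1 : ℤ) * y k - ((k : ℕ) + 1 : ℤ) * x k)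
      = ((i : ℕ) + 1 : ℤ) * y i - ((i : ℕ) + 1 : ℤ) * x i := by
    apply Finset.sum_eq_single i
    · intro j _ hj
      rw [h j hj]; ring
    · simp
  rw [Finset.sum_sub_distrib] at this
  linarith

/-- A multiple of `N` of absolute value less than `N` vanishes. -/
theorem aux_dvd (N d : ℤ) (h : N ∣ d) (h1 : -N < d) (h2 : d < N) : d = 0 :=
  Int.eq_zero_of_abs_lt_dvd h (abs_lt.mpr ⟨h1, h2⟩)

theorem stmt_15 (m : ℕ) (hm : 1 ≤ m)
    (G : SimpleGraph (Fin m → ℤ))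
    (hG : ∀ x y : Fin m → ℤ, G.Adj x y ↔
      ∃ i : Fin m, (x i = y i + 1 ∨ y i = x i + 1) ∧ ∀ j : Fin m, j ≠ i → x j = y j) :
    IsIndepExactCover G 1
      {x : Fin m → ℤ | (2 * (m : ℤ) + 1) ∣ ∑ i : Fin m, ((i : ℕ) + 1 : ℤ) * x i} := by
  refine ⟨?_, ?_⟩
  · intro x hx y hy hxy
    obtain ⟨i, hi, hj⟩ := (hG x y).1 hxy
    simp only [Set.mem_setOf_eq] at hx hy
    rw [aux_sum m x y i hj] at hy
    have hd := (Int.dvd_add_right hx).1 hy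
    have him := i.isLt
    rcases hi with hi | hi
    · have e : y i - x i = -1 := by omega
      rw [e] at hd
      have := aux_dvd _ _ hd (by omega) (by omega)
      omega
    · have e : y i - x i = 1 := by omega
      rw [e] at hd
      have := aux_dvd _ _ hd (by omega) (by omega)
      omega
  · intro v hv
    simp only [Set.mem_setOf_eq] at hv
    rw [Set.ncard_eq_one]
    -- existence of a suitable direction
    have key : ∃ i : Fin m, ∃ e : ℤ, (e = 1 ∨ e = -1) ∧
        (2 * (m : ℤ) + 1) ∣ ∑ k : Fin m, ((k : ℕ) + 1 : ℤ) * v k + ((i : ℕ) + 1 : ℤ) * e := by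
      generalize (∑ k : Fin m, ((k : ℕ) + 1 : ℤ) * v k) = F at hv ⊢
      have hr0 := Int.emod_nonneg F (show (2 * (m : ℤ) + 1) ≠ 0 by omega)
      have hr1 := Int.emod_lt_of_pos F (show 0 < (2 * (m : ℤ) + 1) by omega)
      have hr2 : F % (2 * (m : ℤ) + 1) ≠ 0 := fun h => hv (Int.dvd_of_emod_eq_zero h)
      have hr3 := Int.emod_add_mul_ediv F (2 * (m : ℤ) + 1)
      generalize F % (2 * (m : ℤ) + 1) = r at *
      generalize F / (2 * (m : ℤ) + 1) = q at *
      by_cases hrm : r ≤ m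
      · refine ⟨⟨(r - 1).toNat, by omega⟩, -1, Or.inr rfl, q, ?_⟩
        have : (((r - 1).toNat : ℕ) : ℤ) = r - 1 := Int.toNat_of_nonneg (by omega)
        simp only [this]
        linarith
      · refine ⟨⟨(2 * (m : ℤ) - r).toNat, by omega⟩, 1, Or.inl rfl, q + 1, ?_⟩
        have : (((2 * (m : ℤ) - r).toNat : ℕ) : ℤ) = 2 * (m : ℤ) - r :=
          Int.toNat_of_nonneg (by omega)
        simp only [this]
        linarith
    obtain ⟨i, e, he, hd⟩ := key
    refine ⟨Function.update v i (v i + e), ?_⟩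
    ext y
    simp only [Set.mem_inter_iff, Set.mem_setOf_eq, mem_neighborSet, Set.mem_singleton_iff]
    constructor
    · rintro ⟨hy, hadj⟩
      obtain ⟨j, hj, hk⟩ := (hG v y).1 hadj
      rw [aux_sum m v y j hk] at hy
      have hsub := Int.dvd_sub hy hd
      rw [add_sub_add_left_eq_sub] at hsub
      have him := i.isLt
      have hjm := j.isLt
      have hj' : y j - v j = 1 ∨ y j - v j = -1 := by omega
      have hij : j = i ∧ y j - v j = e := by
        rcases he with rfl | rfl <;> rcases hj' with h | h <;> rw [h] at hsub ⊢ <;>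
          have := aux_dvd _ _ hsub (by omega) (by omega) <;>
          first
            | exact ⟨Fin.ext (by omega), rfl⟩
            | omega
      obtain ⟨rfl, h⟩ := hij
      funext k
      by_cases hkj : k = j
      · subst hkj
        rw [Function.update_self]; omega
      · rw [Function.update_of_ne hkj, hk k hkj]
    · rintro rfl
      have hk : ∀ j : Fin m, j ≠ i → v j = Function.update v i (v i + e) j := by
        intro j hj
        rw [Function.update_of_ne hj]
      refine ⟨?_, (hG _ _).2 ⟨i, ?_, hk⟩⟩
      · rw [aux_sum m v _ i hk, Function.update_self, add_sub_cancel_left]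
        exact hd
      · rw [Function.update_self]; omega
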